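/- Let a_• and b_• be graded families of monomial ideals in R = k[x_1,...,x_n] over a field k. If the Rees algebra R(b_•) is Noetherian, then ρ̂(a_•, overline(b_•)) = sup{λ > 0 : λ·Δ(a_•) ⊄ Δ(b_•)}. -/

import Mathlib

open Filter Pointwise MvPolynomial

noncomputable section

/-- A graded family of ideals: `a p * a q ⊆ a (p+q)` for all `p, q ≥ 1`. -/
def IsGradedFamily {R : Type*} [CommSemiring R] (a : ℕ → Ideal R) : Prop :=
  ∀ p q : ℕ, 1 ≤ p → 1 ≤ q → a p * a q ≤ a (p + q)

/-- The integral closure of an ideal `J`: elements `x` satisfying an equation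
`x^m + c_1 x^{m-1} + ⋯ + c_m = 0` with `c_i ∈ J^i`. -/
def idealIntegralClosure {R : Type*} [CommRing R] (J : Ideal R) : Set R :=
  {x | ∃ m : ℕ, 0 < m ∧ ∃ c : ℕ → R,
    (∀ i ∈ Finset.Icc 1 m, c i ∈ J ^ i) ∧
    x ^ m + ∑ i ∈ Finset.Icc 1 m, c i * x ^ (m - i) = 0}

/-- The asymptotic resurgence
`ρ̂(a_•, B_•) = sup{s/r : s,r ≥ 1, a_{st} ⊄ B_{rt} for all t ≫ 0}` (in `EReal`, so that
the supremum of the empty set is `⊥ = -∞`); the second family is a family of subsets. -/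
def asymptoticResurgence {R : Type*} [CommSemiring R] (a : ℕ → Ideal R) (B : ℕ → Set R) :
    EReal :=
  sSup {x : EReal | ∃ s r : ℕ, 1 ≤ s ∧ 1 ≤ r ∧
    (∀ᶠ t in atTop, ¬ ((a (s * t) : Set R) ⊆ B (r * t))) ∧
    x = (((s : ℝ) / (r : ℝ) : ℝ) : EReal)}

/-- Usual dot product on `ℝⁿ`. -/
def dotProd {n : ℕ} (a b : Fin n → ℝ) : ℝ := ∑ i, a i * b i

/-- The polar set `D° = {a : ⟨a,b⟩ ≥ 1 for all b ∈ D}`. -/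
def polarSet {n : ℕ} (D : Set (Fin n → ℝ)) : Set (Fin n → ℝ) :=
  {a | ∀ b ∈ D, 1 ≤ dotProd a b}

/-- `sup{λ > 0 : λ·A ⊄ B}` as an extended real (`sup ∅ = -∞`). -/
def supScaleNotSubset {n : ℕ} (A B : Set (Fin n → ℝ)) : EReal :=
  sSup {x : EReal | ∃ l : ℝ, 0 < l ∧ ¬ (l • A ⊆ B) ∧ x = ((l : ℝ) : EReal)}

variable {𝕜 : Type*} [Field 𝕜] {n : ℕ}

/-- A monomial ideal: an ideal generated by monomials. -/
def IsMonomialIdeal (I : Ideal (MvPolynomial (Fin n) 𝕜)) : Prop :=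
  ∃ S : Set (Fin n →₀ ℕ), I = Ideal.span ((fun d => monomial d (1 : 𝕜)) '' S)

/-- The Newton polyhedron `NP(I) = conv{d ∈ ℤⁿ_{≥0} : x^d ∈ I}`. -/
def newtonPolyhedron (I : Ideal (MvPolynomial (Fin n) 𝕜)) : Set (Fin n → ℝ) :=
  convexHull ℝ {x | ∃ d : Fin n →₀ ℕ, monomial d (1 : 𝕜) ∈ I ∧ x = fun i => (d i : ℝ)}

/-- The Newton–Okounkov body `Δ(a_•) = closure (⋃_{k ≥ 1} (1/k)·NP(a_k))`. -/
def noBody (a : ℕ → Ideal (MvPolynomial (Fin n) 𝕜)) : Set (Fin n → ℝ) :=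
  closure (⋃ k : ℕ, ⋃ (_ : 1 ≤ k), (k : ℝ)⁻¹ • newtonPolyhedron (a k))

/-- The Rees algebra `R(b_•) = ⊕_{i≥0} b_i t^i ⊆ R[t]` of a graded family, realized as the
`R`-subalgebra of `R[X]` generated by the elements `x·Xⁱ` with `x ∈ b_i`, `i ≥ 1`. -/
def familyReesAlgebra {R : Type*} [CommRing R] (b : ℕ → Ideal R) : Subalgebra R (Polynomial R) :=
  Algebra.adjoin R {f : Polynomial R | ∃ i : ℕ, 1 ≤ i ∧ ∃ x ∈ b i,
    f = Polynomial.C x * Polynomial.X ^ i}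

/-- The exponent of a monomial, as a real vector. -/
def exponentVector (d : Fin n →₀ ℕ) : Fin n → ℝ := fun i => (d i : ℝ)

lemma exponentVector_add (d e : Fin n →₀ ℕ) :
    exponentVector (d + e) = exponentVector d + exponentVector e := by
  ext i; simp [exponentVector]

lemma exponentVector_nsmul (m : ℕ) (d : Fin n →₀ ℕ) :
    exponentVector (m • d) = (m : ℝ) • exponentVector d := by
  ext i; simp [exponentVector]

lemma exponentVector_sum {ι : Type*} (s : Finset ι) (f : ι → Fin n →₀ ℕ) :
    exponentVector (∑ i ∈ s, f i) = ∑ i ∈ s, exponentVector (f i) := by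
  ext i; simp [exponentVector, Finsupp.finsetSum_apply]

lemma exponentVector_injective : Function.Injective (exponentVector (n := n)) := by
  intro d e h
  ext i
  simpa [exponentVector] using congrFun h i

lemma convex_newtonPolyhedron (I : Ideal (MvPolynomial (Fin n) 𝕜)) :
    Convex ℝ (newtonPolyhedron I) :=
  convex_convexHull _ _

lemma exponentVector_mem_newtonPolyhedron {I : Ideal (MvPolynomial (Fin n) 𝕜)} {d : Fin n →₀ ℕ}
    (hd : monomial d (1 : 𝕜) ∈ I) : exponentVector d ∈ newtonPolyhedron I :=
  subset_convexHull ℝ _ ⟨d, hd, rfl⟩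

lemma newtonPolyhedron_subset {I : Ideal (MvPolynomial (Fin n) 𝕜)} {C : Set (Fin n → ℝ)}
    (hC : Convex ℝ C) (h : ∀ d, monomial d (1 : 𝕜) ∈ I → exponentVector d ∈ C) :
    newtonPolyhedron I ⊆ C := by
  refine convexHull_min ?_ hC
  rintro _ ⟨d, hd, rfl⟩
  exact h d hd

lemma monomial_add_mem {I : Ideal (MvPolynomial (Fin n) 𝕜)} {d : Fin n →₀ ℕ} (e : Fin n →₀ ℕ)
    (hd : monomial d (1 : 𝕜) ∈ I) : monomial (e + d) (1 : 𝕜) ∈ I := by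
  have := I.mul_mem_left (monomial e (1 : 𝕜)) hd
  rwa [monomial_mul, one_mul] at this

lemma IsMonomialIdeal.monomial_mem {I : Ideal (MvPolynomial (Fin n) 𝕜)} (hI : IsMonomialIdeal I)
    {f : MvPolynomial (Fin n) 𝕜} (hf : f ∈ I) {d : Fin n →₀ ℕ} (hd : d ∈ f.support) :
    monomial d (1 : 𝕜) ∈ I := by
  obtain ⟨S, rfl⟩ := hI
  rw [mem_ideal_span_monomial_image] at hf ⊢
  intro e he
  rw [Finset.mem_singleton.1 (support_monomial_subset he)]
  exact hf d hd

lemma IsMonomialIdeal.exists_finite {I : Ideal (MvPolynomial (Fin n) 𝕜)}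
    (hI : IsMonomialIdeal I) :
    ∃ S : Set (Fin n →₀ ℕ), S.Finite ∧ ∀ d, monomial d (1 : 𝕜) ∈ I ↔ ∃ e ∈ S, e ≤ d := by
  obtain ⟨S, rfl⟩ := hI
  obtain ⟨T, hTS, hT⟩ := (Submodule.fg_span_iff_fg_span_finset_subset _).1
    (IsNoetherian.noetherian (Ideal.span ((fun d => monomial d (1 : 𝕜)) '' S)))
  classical
  obtain ⟨S', -, rfl⟩ := Finset.subset_set_image_iff.1 hTS
  refine ⟨S', S'.finite_toSet, fun d => ?_⟩
  change Ideal.span _ = Ideal.span _ at hT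
  rw [hT, Finset.coe_image, mem_ideal_span_monomial_image, support_monomial, if_neg one_ne_zero]
  simp

lemma isClosed_newtonPolyhedron {I : Ideal (MvPolynomial (Fin n) 𝕜)} (hI : IsMonomialIdeal I) :
    IsClosed (newtonPolyhedron I) := by
  obtain ⟨S, hS, hmem⟩ := hI.exists_finite
  have hset : {x | ∃ d : Fin n →₀ ℕ, monomial d (1 : 𝕜) ∈ I ∧ x = fun i => (d i : ℝ)} =
      Set.univ.pi (fun _ : Fin n => Set.range (Nat.cast : ℕ → ℝ)) + exponentVector '' S := by
    ext x
    simp only [Set.mem_ofPred_eq, Set.mem_add, Set.mem_pi, Set.mem_univ, true_imp_iff,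
      Set.mem_range, Set.mem_image]
    constructor
    · rintro ⟨d, hd, rfl⟩
      obtain ⟨e, he, hed⟩ := (hmem d).1 hd
      refine ⟨exponentVector (d - e), fun i => ⟨_, rfl⟩, _, ⟨e, he, rfl⟩, ?_⟩
      rw [← exponentVector_add, tsub_add_cancel_of_le hed]
      rfl
    · rintro ⟨u, hu, _, ⟨e, he, rfl⟩, rfl⟩
      choose g hg using hu
      refine ⟨Finsupp.equivFunOnFinite.symm g + e, (hmem _).2 ⟨e, he, le_add_self⟩, ?_⟩
      ext i
      simp [exponentVector, hg]
  have hnat : convexHull ℝ (Set.range (Nat.cast : ℕ → ℝ)) = Set.Ici 0 := by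
    refine (convexHull_min ?_ (convex_Ici (0 : ℝ))).antisymm fun x hx => ?_
    · rintro _ ⟨m, rfl⟩
      exact Set.mem_Ici.2 (Nat.cast_nonneg m)
    · obtain ⟨m, hm⟩ := exists_nat_ge x
      have h0 : (0 : ℝ) ∈ Set.range (Nat.cast : ℕ → ℝ) := ⟨0, Nat.cast_zero⟩
      refine segment_subset_convexHull (𝕜 := ℝ) h0 (Set.mem_range_self m) ?_
      rw [segment_eq_Icc (Nat.cast_nonneg m)]
      exact ⟨hx, hm⟩
  rw [newtonPolyhedron, hset, convexHull_add, convexHull_pi]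
  refine IsClosed.add_right_of_isCompact (isClosed_set_pi fun i _ => ?_)
    ((hS.image _).isCompact_convexHull ℝ)
  rw [hnat]
  exact isClosed_Ici

lemma exponentVector_mem_smul_newtonPolyhedron {J : Ideal (MvPolynomial (Fin n) 𝕜)}
    (hJ : IsMonomialIdeal J) {i : ℕ} (hi : 1 ≤ i) {f : MvPolynomial (Fin n) 𝕜} (hf : f ∈ J ^ i)
    {d : Fin n →₀ ℕ} (hd : d ∈ f.support) :
    exponentVector d ∈ (i : ℝ) • newtonPolyhedron J := by
  classical
  induction i, hi using Nat.le_induction generalizing f d with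
  | base =>
    rw [pow_one] at hf
    simpa using exponentVector_mem_newtonPolyhedron (hJ.monomial_mem hf hd)
  | succ i hi ih =>
    rw [pow_succ] at hf
    refine Submodule.mul_induction_on
      (C := fun f => ∀ d ∈ f.support, exponentVector d ∈ ((i + 1 : ℕ) : ℝ) • newtonPolyhedron J)
      hf ?_ ?_ d hd
    · intro g hg h hh d hd
      obtain ⟨u, hu, v, hv, rfl⟩ := Finset.mem_add.1 (support_mul g h hd)
      rw [Nat.cast_succ, (convex_newtonPolyhedron J).add_smul i.cast_nonneg zero_le_one, one_smul,
        exponentVector_add]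
      exact Set.add_mem_add (ih hg hu)
        (exponentVector_mem_newtonPolyhedron (hJ.monomial_mem hh hv))
    · intro g h hg hh d hd
      rcases Finset.mem_union.1 (support_add hd) with hd | hd
      exacts [hg d hd, hh d hd]

lemma exponentVector_mem_newtonPolyhedron_of_integral {J : Ideal (MvPolynomial (Fin n) 𝕜)}
    (hJ : IsMonomialIdeal J) {d : Fin n →₀ ℕ}
    (hd : monomial d (1 : 𝕜) ∈ idealIntegralClosure J) :
    exponentVector d ∈ newtonPolyhedron J := by
  obtain ⟨m, hm, c, hc, heq⟩ := hd
  obtain ⟨i, hi, hne⟩ : ∃ i ∈ Finset.Icc 1 m, coeff (i • d) (c i) ≠ 0 := by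
    by_contra! hall
    have h := congrArg (coeff (m • d)) heq
    rw [coeff_add, coeff_sum, Finset.sum_eq_zero, monomial_pow] at h
    · simp at h
    · intro i hi
      have him := (Finset.mem_Icc.1 hi).2
      have : m • d = i • d + (m - i) • d := by rw [← add_smul, Nat.add_sub_cancel' him]
      rw [monomial_pow, this, coeff_mul_monomial, hall i hi, zero_mul]
  have hi1 := (Finset.mem_Icc.1 hi).1
  have := exponentVector_mem_smul_newtonPolyhedron hJ hi1 (hc i hi) (mem_support_iff.2 hne)
  rw [exponentVector_nsmul] at this
  exact (Set.smul_mem_smul_set_iff₀ (by positivity) _ _).1 this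

/-- An element `f` is integral over the ideal `J` if `f * X` is integral over the Rees algebra. -/
lemma mem_idealIntegralClosure_of_isIntegral {R : Type*} [CommRing R] [Nontrivial R] {J : Ideal R}
    {f : R} (hf : IsIntegral (reesAlgebra J) (Polynomial.monomial 1 f)) :
    f ∈ idealIntegralClosure J := by
  obtain ⟨p, hp, hpf⟩ := hf
  have hpos : 0 < p.natDegree := by
    by_contra! h
    rw [Polynomial.eq_one_of_monic_natDegree_zero hp (by omega)] at hpf
    simp at hpf
  refine ⟨p.natDegree, hpos, fun i => (p.coeff (p.natDegree - i) : Polynomial R).coeff i,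
    fun i _ => (p.coeff (p.natDegree - i)).2 i, ?_⟩
  have h := congrArg (fun q => Polynomial.coeff q p.natDegree) hpf
  simp only [Polynomial.eval₂_eq_sum_range, Polynomial.finsetSum_coeff, Polynomial.monomial_pow,
    Polynomial.coeff_zero, one_mul, Subalgebra.algebraMap_def] at h
  rw [Finset.sum_range_succ, add_comm] at h
  rw [← h]
  congr 1
  · simp [hp]
  · refine Finset.sum_nbij' (p.natDegree - ·) (p.natDegree - ·) ?_ ?_ ?_ ?_ ?_ <;> intro i hi
    · simp only [Finset.mem_Icc, Finset.mem_range] at hi ⊢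
      omega
    · simp only [Finset.mem_Icc, Finset.mem_range] at hi ⊢
      omega
    · simp only [Finset.mem_Icc] at hi
      omega
    · simp only [Finset.mem_range] at hi
      omega
    · have him : p.natDegree = i + (p.natDegree - i) := by
        simp only [Finset.mem_Icc] at hi
        omega
      have h := Polynomial.coeff_mul_monomial (p.coeff (p.natDegree - i)).1 (p.natDegree - i) i
        (f ^ (p.natDegree - i))
      rw [← him] at h
      exact h.symm

lemma mem_idealIntegralClosure_of_monomial {J : Ideal (MvPolynomial (Fin n) 𝕜)}
    {f : MvPolynomial (Fin n) 𝕜}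
    (hf : ∀ d ∈ f.support, ∃ N : ℕ, 0 < N ∧ monomial (N • d) (1 : 𝕜) ∈ J ^ N) :
    f ∈ idealIntegralClosure J := by
  apply mem_idealIntegralClosure_of_isIntegral
  rw [f.as_sum, map_sum]
  refine IsIntegral.sum _ fun d hd => ?_
  obtain ⟨N, hN, hmem⟩ := hf d hd
  refine IsIntegral.of_pow hN ?_
  rw [Polynomial.monomial_pow, one_mul, monomial_pow]
  have : Polynomial.monomial N (monomial (N • d) (coeff d f ^ N)) ∈ reesAlgebra J := by
    rw [reesAlgebra.monomial_mem]
    have := (J ^ N).mul_mem_left (C (coeff d f ^ N)) hmem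
    rwa [C_mul_monomial, mul_one] at this
  exact isIntegral_algebraMap (R := reesAlgebra J) (x := ⟨_, this⟩)

lemma exists_common_denominator {ι : Type*} [Fintype ι] (q : ι → ℚ) (hq : ∀ i, 0 ≤ q i) :
    ∃ N : ℕ, 0 < N ∧ ∃ k : ι → ℕ, ∀ i, (k i : ℚ) = N * q i := by
  classical
  refine ⟨∏ i, (q i).den, Finset.prod_pos fun i _ => (q i).den_pos,
    fun i => (∏ j ∈ Finset.univ.erase i, (q j).den) * (q i).num.toNat, fun i => ?_⟩
  rw [← Finset.prod_erase_mul _ _ (Finset.mem_univ i)]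
  have h1 : (((q i).num.toNat : ℕ) : ℚ) = (q i).num := by
    exact_mod_cast Int.toNat_of_nonneg (Rat.num_nonneg.2 (hq i))
  push_cast
  rw [h1, mul_assoc, mul_comm ((q i).den : ℚ), Rat.mul_den_eq_num]

/-- The weights of a rational point in an affine basis of rational points are rational. -/
lemma exists_rat_weights {ι : Type*} [Fintype ι] {e : ι → Fin n →₀ ℕ} {d : Fin n →₀ ℕ}
    (hind : AffineIndependent ℝ fun i => exponentVector (e i)) {w : ι → ℝ} (hw : ∑ i, w i = 1)
    (hd : ∑ i, w i • exponentVector (e i) = exponentVector d) :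
    ∃ q : ι → ℚ, ∀ i, w i = q i := by
  obtain ⟨φ, hφ⟩ := (Algebra.linearMap ℚ ℝ).exists_leftInverse_of_injective
    (LinearMap.ker_eq_bot.2 (algebraMap ℚ ℝ).injective)
  have hφ' (q : ℚ) : φ (q : ℝ) = q := by simpa using LinearMap.congr_fun hφ q
  have hφn (m : ℕ) : φ (m : ℝ) = m := by simpa using hφ' m
  refine ⟨fun i => φ (w i), fun i => sub_eq_zero.1 ?_⟩
  refine affineIndependent_iff.1 hind Finset.univ (fun i => w i - (φ (w i) : ℝ)) ?_ ?_ i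
    (Finset.mem_univ i)
  · rw [Finset.sum_sub_distrib, hw, ← Rat.cast_sum, ← map_sum, hw]
    have := hφn 1
    simp only [Nat.cast_one] at this
    simp [this]
  · simp only [sub_smul, Finset.sum_sub_distrib, hd]
    ext j
    have h1 := congrArg φ (congrFun hd j)
    simp only [Finset.sum_apply, Pi.smul_apply, smul_eq_mul, exponentVector, map_sum, hφn] at h1
    have h2 (i : ι) : φ (w i * (e i j : ℝ)) = φ (w i) * e i j := by
      rw [mul_comm, ← nsmul_eq_mul, map_nsmul, nsmul_eq_mul, mul_comm]
    simp only [h2] at h1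
    simp only [Pi.sub_apply, Finset.sum_apply, Pi.smul_apply, smul_eq_mul, exponentVector,
      Pi.zero_apply]
    rw [sub_eq_zero]
    exact_mod_cast h1.symm

lemma exists_monomial_nsmul_mem_pow {J : Ideal (MvPolynomial (Fin n) 𝕜)} {d : Fin n →₀ ℕ}
    (hd : exponentVector d ∈ newtonPolyhedron J) :
    ∃ N : ℕ, 0 < N ∧ monomial (N • d) (1 : 𝕜) ∈ J ^ N := by
  obtain ⟨ι, _, z, w, hz, hind, hw0, hw1, hsum⟩ := eq_pos_convex_span_of_mem_convexHull hd
  have hz' (i : ι) : ∃ e : Fin n →₀ ℕ, monomial e (1 : 𝕜) ∈ J ∧ z i = exponentVector e :=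
    hz ⟨i, rfl⟩
  choose e heJ hze using hz'
  obtain rfl : z = fun i => exponentVector (e i) := funext hze
  obtain ⟨q, hq⟩ := exists_rat_weights hind hw1 hsum
  obtain ⟨N, hN, k, hk⟩ := exists_common_denominator q fun i => by
    exact_mod_cast (hq i ▸ hw0 i).le
  have hk' (i : ι) : (k i : ℝ) = N * w i := by rw [hq]; exact_mod_cast hk i
  have hkN : ∑ i, k i = N := by
    have : ((∑ i, k i : ℕ) : ℝ) = N := by
      push_cast
      simp only [hk', ← Finset.mul_sum, hw1, mul_one]
    exact_mod_cast this
  have hNd : N • d = ∑ i, k i • e i := by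
    apply exponentVector_injective
    rw [exponentVector_sum, exponentVector_nsmul, ← hsum, Finset.smul_sum]
    refine Finset.sum_congr rfl fun i _ => ?_
    rw [exponentVector_nsmul, hk', smul_smul]
  refine ⟨N, hN, ?_⟩
  rw [hNd, monomial_sum_one, ← hkN, ← Finset.prod_pow_eq_pow_sum]
  refine Ideal.prod_mem_prod fun i _ => ?_
  have := Ideal.pow_mem_pow (heJ i) (k i)
  rwa [monomial_pow, one_pow] at this

lemma mem_idealIntegralClosure_of_exponentVector_mem {J : Ideal (MvPolynomial (Fin n) 𝕜)}
    {f : MvPolynomial (Fin n) 𝕜} (hf : ∀ d ∈ f.support, exponentVector d ∈ newtonPolyhedron J) :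
    f ∈ idealIntegralClosure J :=
  mem_idealIntegralClosure_of_monomial fun d hd => exists_monomial_nsmul_mem_pow (hf d hd)

lemma IsGradedFamily.pow_mem {R : Type*} [CommSemiring R] {b : ℕ → Ideal R}
    (hb : IsGradedFamily b) {c t : ℕ} (hc : 1 ≤ c) (ht : 1 ≤ t) {x : R} (hx : x ∈ b c) :
    x ^ t ∈ b (c * t) := by
  induction t, ht using Nat.le_induction with
  | base => simpa
  | succ t ht ih =>
    rw [pow_succ, mul_add_one]
    exact hb _ _ (Nat.mul_pos hc ht) hc (Ideal.mul_mem_mul ih hx)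

lemma IsGradedFamily.monomial_nsmul_mem {b : ℕ → Ideal (MvPolynomial (Fin n) 𝕜)}
    (hb : IsGradedFamily b) {c t : ℕ} (hc : 1 ≤ c) (ht : 1 ≤ t) {d : Fin n →₀ ℕ}
    (hd : monomial d (1 : 𝕜) ∈ b c) : monomial (t • d) (1 : 𝕜) ∈ b (c * t) := by
  have := hb.pow_mem hc ht hd
  rwa [monomial_pow, one_pow] at this

lemma IsGradedFamily.smul_newtonPolyhedron_subset {b : ℕ → Ideal (MvPolynomial (Fin n) 𝕜)}
    (hb : IsGradedFamily b) {c t : ℕ} (hc : 1 ≤ c) (ht : 1 ≤ t) :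
    (t : ℝ) • newtonPolyhedron (b c) ⊆ newtonPolyhedron (b (c * t)) := by
  rw [newtonPolyhedron, ← convexHull_smul]
  refine convexHull_min ?_ (convex_newtonPolyhedron _)
  rintro _ ⟨_, ⟨d, hd, rfl⟩, rfl⟩
  have := exponentVector_mem_newtonPolyhedron (hb.monomial_nsmul_mem hc ht hd)
  rwa [exponentVector_nsmul] at this

lemma IsGradedFamily.coeff_mem {R : Type*} [CommRing R] {b : ℕ → Ideal R}
    (hb : IsGradedFamily b) {f : Polynomial R} (hf : f ∈ familyReesAlgebra b) {m : ℕ}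
    (hm : 1 ≤ m) : f.coeff m ∈ b m := by
  induction hf using Algebra.adjoin_induction generalizing m with
  | mem f hf =>
    obtain ⟨i, hi, x, hx, rfl⟩ := hf
    rw [Polynomial.coeff_C_mul_X_pow]
    split_ifs with h
    · rwa [h]
    · exact zero_mem _
  | algebraMap r =>
    rw [Polynomial.algebraMap_apply, Polynomial.coeff_C_of_ne_zero (by omega)]
    exact zero_mem _
  | add f g _ _ hf hg =>
    rw [Polynomial.coeff_add]
    exact add_mem (hf hm) (hg hm)
  | mul f g _ _ hf hg =>
    rw [Polynomial.coeff_mul]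
    refine sum_mem fun ⟨i, j⟩ hij => ?_
    obtain rfl := Finset.HasAntidiagonal.mem_antidiagonal.1 hij
    rcases Nat.eq_zero_or_pos i with rfl | hi
    · rw [zero_add] at hm ⊢
      exact Ideal.mul_mem_left _ _ (hg hm)
    rcases Nat.eq_zero_or_pos j with rfl | hj
    · exact Ideal.mul_mem_right _ _ (hf hm)
    · exact hb _ _ hi hj (Ideal.mul_mem_mul (hf hi) (hg hj))

/-- If the Rees algebra is Noetherian, then monomials in the family of large degree are products of
monomials in the family of smaller degree. -/
lemma IsGradedFamily.exists_bound_decomposition {b : ℕ → Ideal (MvPolynomial (Fin n) 𝕜)}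
    (hb : IsGradedFamily b) (hbMon : ∀ i : ℕ, 1 ≤ i → IsMonomialIdeal (b i))
    (hNoeth : IsNoetherianRing (familyReesAlgebra b)) :
    ∃ D : ℕ, ∀ k, D < k → ∀ d, monomial d (1 : 𝕜) ∈ b k →
      ∃ i, 1 ≤ i ∧ i < k ∧ ∃ u v, d = u + v ∧ monomial u (1 : 𝕜) ∈ b (k - i) ∧
        monomial v (1 : 𝕜) ∈ b i := by
  classical
  let S : Set (familyReesAlgebra b) := {g | ∃ i : ℕ, 1 ≤ i ∧ ∃ x ∈ b i,
    (g : Polynomial (MvPolynomial (Fin n) 𝕜)) = Polynomial.C x * Polynomial.X ^ i}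
  obtain ⟨T, hTS, hT⟩ := (Submodule.fg_span_iff_fg_span_finset_subset _).1
    (IsNoetherian.noetherian (Ideal.span S))
  have hdeg (g : familyReesAlgebra b) : ∃ i : ℕ, g ∈ S → 1 ≤ i ∧ ∃ x ∈ b i,
      (g : Polynomial (MvPolynomial (Fin n) 𝕜)) = Polynomial.C x * Polynomial.X ^ i := by
    by_cases hg : g ∈ S
    · obtain ⟨i, hi⟩ := hg
      exact ⟨i, fun _ => hi⟩
    · exact ⟨0, fun h => absurd h hg⟩
  choose deg hdeg using hdeg
  refine ⟨T.sup deg, fun k hk d hd => ?_⟩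
  have hk1 : 1 ≤ k := by omega
  let z : familyReesAlgebra b := ⟨Polynomial.C (monomial d (1 : 𝕜)) * Polynomial.X ^ k,
    Algebra.subset_adjoin ⟨k, hk1, _, hd, rfl⟩⟩
  have hz : z ∈ Submodule.span (familyReesAlgebra b) (T : Set (familyReesAlgebra b)) :=
    hT ▸ Submodule.subset_span ⟨k, hk1, _, hd, rfl⟩
  obtain ⟨f, -, hf⟩ := Submodule.mem_span_finset.1 hz
  have hcoeff : ∑ g ∈ T, coeff d (((f g * g : familyReesAlgebra b) :
      Polynomial (MvPolynomial (Fin n) 𝕜)).coeff k) = 1 := by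
    have h := congrArg (fun y : familyReesAlgebra b =>
      coeff d ((y : Polynomial (MvPolynomial (Fin n) 𝕜)).coeff k)) hf
    simpa [z, Polynomial.finsetSum_coeff, coeff_sum] using h
  obtain ⟨g, hg, hne⟩ := Finset.exists_ne_zero_of_sum_ne_zero (hcoeff.trans_ne one_ne_zero)
  obtain ⟨hi, x, hx, hgx⟩ := hdeg g (hTS hg)
  have hik : deg g < k := (Finset.le_sup hg).trans_lt hk
  rw [MulMemClass.coe_mul, hgx, ← mul_assoc, Polynomial.coeff_mul_X_pow', if_pos hik.le,
    Polynomial.coeff_mul_C] at hne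
  obtain ⟨u, hu, v, hv, huv⟩ := Finset.mem_add.1 (support_mul _ _ (mem_support_iff.2 hne))
  exact ⟨deg g, hi, hik, u, v, huv.symm,
    (hbMon _ (by omega)).monomial_mem (hb.coeff_mem (f g).2 (by omega)) hu,
    (hbMon _ hi).monomial_mem hx hv⟩

lemma IsGradedFamily.exists_newtonPolyhedron_bound {b : ℕ → Ideal (MvPolynomial (Fin n) 𝕜)}
    (hb : IsGradedFamily b) (hbMon : ∀ i : ℕ, 1 ≤ i → IsMonomialIdeal (b i))
    (hNoeth : IsNoetherianRing (familyReesAlgebra b)) :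
    ∃ c : ℕ, 1 ≤ c ∧ ∀ k, 1 ≤ k → ∀ d, monomial d (1 : 𝕜) ∈ b k →
      (c : ℝ) • exponentVector d ∈ (k : ℝ) • newtonPolyhedron (b c) := by
  obtain ⟨D, hD⟩ := hb.exists_bound_decomposition hbMon hNoeth
  refine ⟨D.factorial, D.factorial_pos, fun k => ?_⟩
  induction k using Nat.strong_induction_on with
  | _ k ih =>
    intro hk d hd
    rcases le_or_gt k D with hkD | hkD
    · obtain ⟨q, hq⟩ := Nat.dvd_factorial hk hkD
      have hq1 : 1 ≤ q := Nat.pos_of_mul_pos_left (hq ▸ D.factorial_pos)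
      have := exponentVector_mem_newtonPolyhedron (hb.monomial_nsmul_mem hk hq1 hd)
      rw [hq, Nat.cast_mul, mul_smul, ← exponentVector_nsmul]
      exact Set.smul_mem_smul_set this
    · obtain ⟨i, hi, hik, u, v, rfl, hu, hv⟩ := hD k hkD d hd
      have hcast : (k : ℝ) = ((k - i : ℕ) : ℝ) + (i : ℝ) := by
        rw [← Nat.cast_add, Nat.sub_add_cancel hik.le]
      rw [exponentVector_add, smul_add, hcast, (convex_newtonPolyhedron _).add_smul
        (Nat.cast_nonneg _) (Nat.cast_nonneg _)]
      exact Set.add_mem_add (ih _ (by omega) (by omega) u hu) (ih i hik hi v hv)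

lemma inv_smul_newtonPolyhedron_subset_noBody (b : ℕ → Ideal (MvPolynomial (Fin n) 𝕜)) {k : ℕ}
    (hk : 1 ≤ k) : (k : ℝ)⁻¹ • newtonPolyhedron (b k) ⊆ noBody b :=
  (Set.subset_iUnion₂ (s := fun (k : ℕ) (_ : 1 ≤ k) => (k : ℝ)⁻¹ • newtonPolyhedron (b k))
    k hk).trans subset_closure

lemma IsGradedFamily.exists_noBody_eq {b : ℕ → Ideal (MvPolynomial (Fin n) 𝕜)}
    (hb : IsGradedFamily b) (hbMon : ∀ i : ℕ, 1 ≤ i → IsMonomialIdeal (b i))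
    (hNoeth : IsNoetherianRing (familyReesAlgebra b)) :
    ∃ c : ℕ, 1 ≤ c ∧ noBody b = (c : ℝ)⁻¹ • newtonPolyhedron (b c) := by
  obtain ⟨c, hc, h⟩ := hb.exists_newtonPolyhedron_bound hbMon hNoeth
  have hc0 : (c : ℝ) ≠ 0 := by positivity
  refine ⟨c, hc, Set.Subset.antisymm (closure_minimal (Set.iUnion₂_subset fun k hk => ?_) ?_)
    (inv_smul_newtonPolyhedron_subset_noBody b hc)⟩
  · have hk0 : (k : ℝ) ≠ 0 := by positivity
    rw [Set.smul_set_subset_iff₀ (inv_ne_zero hk0), inv_inv]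
    refine newtonPolyhedron_subset (((convex_newtonPolyhedron _).smul _).smul _) fun d hd => ?_
    rw [smul_comm, Set.mem_inv_smul_set_iff₀ hc0]
    exact h k hk d hd
  · exact (isClosed_newtonPolyhedron (hbMon c hc)).smul₀ _

/-- Theorem `thm.rhohatViaNO`(1). For graded families `a_•`, `b_•` of
monomial ideals in `k[x_1,…,x_n]` with `R(b_•)` Noetherian,
`ρ̂(a_•, overline(b_•)) = sup{λ > 0 : λ·Δ(a_•) ⊄ Δ(b_•)}`. -/
theorem asymptoticResurgence_eq_supScaleNotSubset_noBody
    (a b : ℕ → Ideal (MvPolynomial (Fin n) 𝕜))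
    (ha : IsGradedFamily a) (hb : IsGradedFamily b)
    (haMon : ∀ i : ℕ, 1 ≤ i → IsMonomialIdeal (a i))
    (hbMon : ∀ i : ℕ, 1 ≤ i → IsMonomialIdeal (b i))
    (hNoeth : IsNoetherianRing (familyReesAlgebra b)) :
    asymptoticResurgence a (fun t => idealIntegralClosure (b t)) =
      supScaleNotSubset (noBody a) (noBody b) := by
  obtain ⟨c, hc, hbody⟩ := hb.exists_noBody_eq hbMon hNoeth
  have hc0 : (c : ℝ) ≠ 0 := by positivity
  apply le_antisymm
  · refine sSup_le_sSup ?_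
    rintro _ ⟨s, r, hs, hr, hev, rfl⟩
    refine ⟨s / r, by positivity, fun hsub => ?_, rfl⟩
    obtain ⟨t, ht, hnot⟩ := ((eventually_ge_atTop 1).and
      ((tendsto_id.const_mul_atTop' hc).eventually hev)).exists
    have hct : 1 ≤ c * t := Nat.mul_pos hc ht
    have hsct : 1 ≤ s * (c * t) := Nat.mul_pos hs hct
    refine hnot fun f hf => mem_idealIntegralClosure_of_exponentVector_mem fun d hd => ?_
    have hd' := exponentVector_mem_newtonPolyhedron ((haMon _ hsct).monomial_mem hf hd)
    have hmem := hsub (Set.smul_mem_smul_set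
      (inv_smul_newtonPolyhedron_subset_noBody a hsct (Set.smul_mem_smul_set hd')))
    rw [hbody, Set.mem_inv_smul_set_iff₀ hc0, smul_smul, smul_smul] at hmem
    have hrt : 1 ≤ r * t := Nat.mul_pos hr ht
    have hfin := hb.smul_newtonPolyhedron_subset hc hrt
      (Set.smul_mem_smul_set (a := ((r * t : ℕ) : ℝ)) hmem)
    have hone : ((r * t : ℕ) : ℝ) * (c * (s / r) * ((s * (c * t) : ℕ) : ℝ)⁻¹) = 1 := by
      push_cast
      field_simp
    rw [smul_smul, hone, one_smul] at hfin
    rwa [id, show r * (c * t) = c * (r * t) by ring]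
  · refine sSup_le ?_
    rintro _ ⟨l, hl, hnot, rfl⟩
    have hclosed : IsClosed (noBody b) := isClosed_closure
    have hconv : Convex ℝ (noBody b) := hbody ▸ (convex_newtonPolyhedron _).smul _
    obtain ⟨k, hk, d, hd, hld⟩ : ∃ k : ℕ, 1 ≤ k ∧ ∃ d, monomial d (1 : 𝕜) ∈ a k ∧
        l • (k : ℝ)⁻¹ • exponentVector d ∉ noBody b := by
      by_contra! hall
      refine hnot ?_
      rw [Set.smul_set_subset_iff₀ hl.ne']
      refine closure_minimal (Set.iUnion₂_subset fun k hk => ?_) (hclosed.smul₀ _)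
      have hk0 : (k : ℝ) ≠ 0 := by positivity
      rw [Set.smul_set_subset_iff₀ (inv_ne_zero hk0)]
      refine newtonPolyhedron_subset ((hconv.smul _).smul _) fun d hd => ?_
      rw [Set.mem_inv_smul_set_iff₀ (inv_ne_zero hk0), Set.mem_inv_smul_set_iff₀ hl.ne']
      exact hall k hk d hd
    have hcont : Continuous fun x : ℝ => x • (k : ℝ)⁻¹ • exponentVector d := by fun_prop
    obtain ⟨ε, hε, hball⟩ := Metric.isOpen_iff.1 (hclosed.isOpen_compl.preimage hcont) l hld
    obtain ⟨q, hlq, hqε⟩ := exists_rat_btwn (lt_add_of_pos_right l hε)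
    have hqnot : (q : ℝ) • (k : ℝ)⁻¹ • exponentVector d ∉ noBody b := by
      refine hball ?_
      rw [Metric.mem_ball, Real.dist_eq, abs_of_pos (sub_pos.2 hlq)]
      linarith
    have hq0 : 0 < q := by exact_mod_cast hl.trans hlq
    obtain ⟨s, hs⟩ := Int.eq_ofNat_of_zero_le (Rat.num_nonneg.2 hq0.le)
    have hs1 : 1 ≤ s := by have := Rat.num_pos.2 hq0; omega
    have hqs : (q : ℝ) = s / q.den := by
      rw [Rat.cast_def, hs]
      simp
    have hk0 : (k : ℝ) ≠ 0 := by positivity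
    have hden : (q.den : ℝ) ≠ 0 := by exact_mod_cast q.den_ne_zero
    refine le_trans (EReal.coe_le_coe_iff.2 hlq.le) (le_sSup ⟨k * s, k * q.den,
      Nat.mul_pos hk hs1, Nat.mul_pos hk q.den_pos, ?_, ?_⟩)
    · filter_upwards [eventually_ge_atTop 1] with t ht hsub
      have hkr : 1 ≤ k * q.den * t := Nat.mul_pos (Nat.mul_pos hk q.den_pos) ht
      have hst : 1 ≤ s * t := Nat.mul_pos hs1 ht
      have hmem := ha.monomial_nsmul_mem hk hst hd
      rw [← mul_assoc] at hmem
      have hNP := exponentVector_mem_newtonPolyhedron_of_integral (hbMon _ hkr) (hsub hmem)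
      have := inv_smul_newtonPolyhedron_subset_noBody b hkr (Set.smul_mem_smul_set hNP)
      refine hqnot ?_
      convert this using 1
      rw [exponentVector_nsmul, smul_smul, smul_smul, hqs]
      congr 1
      have ht0 : (t : ℝ) ≠ 0 := by positivity
      push_cast
      field_simp
    · rw [hqs]
      congr 1
      push_cast
      field_simp

end
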